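/- arXiv:2002.06404 — 4 statements merged into one kernel-verified Lean document; each statement's English description precedes it below -/
import Mathlib

section
/- Let ≤ be a monomial order on R^r, let q ∈ R and p ∈ R^r be nonzero, and let ī be the support of lm_≤(p). Then lm_≤(q·p) = lm_{≤_ī}(q) · lm_≤(p), where lm_{≤_ī}(q) is the leading monomial of q for the order ≤_ī induced on R by the ī-th coordinate. -/
open MvPolynomial

/-! ### Monomials of the free module `R^r`, monomial orders, Gröbner bases

Here `R = K[X₁,…,Xₙ]` is `MvPolynomial (Fin n) K` and the free module `R^r`
is `Fin r → MvPolynomial (Fin n) K` (row vectors).  A monomial `ν eᵢ` of `R^r`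
is encoded as a pair `(ν, i)`. -/

/-- A monomial of the free module `R^r`: an exponent vector in `n` variables
together with the index of the coordinate vector supporting it. -/
abbrev ModMon (n r : ℕ) := (Fin n →₀ ℕ) × Fin r

/-- Multiplication of a module monomial by a ring monomial. -/
noncomputable def smulMon {n r : ℕ} (ν : Fin n →₀ ℕ) (μ : ModMon n r) : ModMon n r :=
  (ν + μ.1, μ.2)

/-- A monomial order on `R^r`: a total order on the monomials of `R^r` such that
`μ₁ ≤ μ₂` implies `μ₁ ≤ ν·μ₁ ≤ ν·μ₂` for every ring monomial `ν`. -/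
structure ModMonomialOrder (n r : ℕ) where
  le : ModMon n r → ModMon n r → Prop
  le_refl : ∀ a, le a a
  le_trans : ∀ a b c, le a b → le b c → le a c
  le_antisymm : ∀ a b, le a b → le b a → a = b
  le_total : ∀ a b, le a b ∨ le b a
  compat : ∀ (ν : Fin n →₀ ℕ) (a b : ModMon n r),
    le a b → le a (smulMon ν a) ∧ le (smulMon ν a) (smulMon ν b)

/-- The strict order associated with a monomial order. -/
def ModMonomialOrder.lt {n r : ℕ} (ord : ModMonomialOrder n r)
    (a b : ModMon n r) : Prop :=
  ord.le a b ∧ a ≠ b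

/-- The module monomial `μ = ν eᵢ` as an element of `R^r`. -/
noncomputable def monElem (K : Type) [Field K] {n r : ℕ} (μ : ModMon n r) :
    Fin r → MvPolynomial (Fin n) K :=
  Pi.single μ.2 (monomial μ.1 (1 : K))

/-- `μ` is the `ord`-leading monomial of `p ∈ R^r`: it appears in `p` and every
monomial appearing in `p` is `≤ μ`. -/
def IsLM {K : Type} [Field K] {n r : ℕ} (ord : ModMonomialOrder n r)
    (p : Fin r → MvPolynomial (Fin n) K) (μ : ModMon n r) : Prop :=
  coeff μ.1 (p μ.2) ≠ 0 ∧
  ∀ (m : Fin n →₀ ℕ) (i : Fin r), coeff m (p i) ≠ 0 → ord.le (m, i) μ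

/-- Divisibility of module monomials: `μ ∣ μ'` iff `μ' = ν·μ` for a ring monomial `ν`. -/
def monDvd {n r : ℕ} (μ μ' : ModMon n r) : Prop :=
  ∃ ν : Fin n →₀ ℕ, smulMon ν μ = μ'

/-- The `ord`-leading module of a submodule `M ⊆ R^r`: the submodule generated by
the leading monomials of the nonzero elements of `M`. -/
noncomputable def leadingSubmodule {K : Type} [Field K] {n r : ℕ}
    (ord : ModMonomialOrder n r)
    (M : Submodule (MvPolynomial (Fin n) K) (Fin r → MvPolynomial (Fin n) K)) :
    Submodule (MvPolynomial (Fin n) K) (Fin r → MvPolynomial (Fin n) K) :=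
  Submodule.span (MvPolynomial (Fin n) K)
    {v | ∃ p ∈ M, ∃ μ : ModMon n r, IsLM ord p μ ∧ v = monElem K μ}

/-- `G` is a `ord`-Gröbner basis of `M`. -/
def IsGB {K : Type} [Field K] {n r : ℕ} {ι : Type} (ord : ModMonomialOrder n r)
    (M : Submodule (MvPolynomial (Fin n) K) (Fin r → MvPolynomial (Fin n) K))
    (G : ι → Fin r → MvPolynomial (Fin n) K) : Prop :=
  (∀ i, G i ∈ M) ∧
  leadingSubmodule ord M =
    Submodule.span (MvPolynomial (Fin n) K)
      {v | ∃ (i : ι) (μ : ModMon n r), IsLM ord (G i) μ ∧ v = monElem K μ}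

/-- `G` is a minimal `ord`-Gröbner basis of `M`: no leading monomial of an element
divides that of another element. -/
def IsMinimalGB {K : Type} [Field K] {n r : ℕ} {ι : Type} (ord : ModMonomialOrder n r)
    (M : Submodule (MvPolynomial (Fin n) K) (Fin r → MvPolynomial (Fin n) K))
    (G : ι → Fin r → MvPolynomial (Fin n) K) : Prop :=
  IsGB ord M G ∧
  ∀ (i j : ι), i ≠ j → ∀ (μi μj : ModMon n r),
    IsLM ord (G i) μi → IsLM ord (G j) μj → ¬ monDvd μi μj

/-- `G` is the reduced `ord`-Gröbner basis of `M`: minimal, leading coefficients `1`,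
and no term of `G i` is divisible by the leading monomial of `G j` for `j ≠ i`. -/
def IsReducedGB {K : Type} [Field K] {n r : ℕ} {ι : Type} (ord : ModMonomialOrder n r)
    (M : Submodule (MvPolynomial (Fin n) K) (Fin r → MvPolynomial (Fin n) K))
    (G : ι → Fin r → MvPolynomial (Fin n) K) : Prop :=
  IsMinimalGB ord M G ∧
  (∀ (i : ι) (μi : ModMon n r), IsLM ord (G i) μi → coeff μi.1 (G i μi.2) = 1) ∧
  (∀ (i j : ι), i ≠ j → ∀ (μj : ModMon n r), IsLM ord (G j) μj →
    ∀ (m : Fin n →₀ ℕ) (l : Fin r), coeff m (G i l) ≠ 0 → ¬ monDvd μj (m, l))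

/-- The rows of the elementary matrix `E ∈ R^{(k+n-1)×k}` with pivot `π`,
constants `lam i` (for `i ≠ π`) and `α j`: the rows `εᵢ + λᵢ ε_π` for `i ≠ π`
and `(Xⱼ - αⱼ) ε_π` for `1 ≤ j ≤ n`. -/
noncomputable def elemRow {K : Type} [Field K] {n k : ℕ} (π : Fin k)
    (lam : Fin k → K) (α : Fin n → K) :
    ({i : Fin k // i ≠ π} ⊕ Fin n) → Fin k → MvPolynomial (Fin n) K :=
  Sum.elim
    (fun i => Pi.single i.1 (1 : MvPolynomial (Fin n) K)
      + lam i.1 • (Pi.single π 1 : Fin k → MvPolynomial (Fin n) K))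
    (fun j => (X j - C (α j)) • (Pi.single π 1 : Fin k → MvPolynomial (Fin n) K))

/-- Rows of the matrix product `E·G` where `E` has rows in `R^k` indexed by `ι`
and `G ∈ R^{k×r}`. -/
noncomputable def rowMul {K : Type} [Field K] {n k r : ℕ} {ι : Type}
    (E : ι → Fin k → MvPolynomial (Fin n) K)
    (G : Fin k → Fin r → MvPolynomial (Fin n) K) :
    ι → Fin r → MvPolynomial (Fin n) K :=
  fun a c => ∑ b, E a b * G b c

/-- `sord` is a Schreyer order for `ord` and the list of monomials `LM`. -/
def IsSchreyerOrder {n r k : ℕ} (ord : ModMonomialOrder n r)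
    (LM : Fin k → ModMon n r) (sord : ModMonomialOrder n k) : Prop :=
  ∀ (ν₁ ν₂ : Fin n →₀ ℕ) (i j : Fin k),
    ord.lt (smulMon ν₁ (LM i)) (smulMon ν₂ (LM j)) → sord.le (ν₁, i) (ν₂, j)

/-- Row vector times matrix, as a linear map `R^r → R^s`. -/
noncomputable def vecMulLin {K : Type} [Field K] {n r s : ℕ}
    (F : Fin r → Fin s → MvPolynomial (Fin n) K) :
    (Fin r → MvPolynomial (Fin n) K) →ₗ[MvPolynomial (Fin n) K]
      (Fin s → MvPolynomial (Fin n) K) :=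
  Matrix.vecMulLinear (Matrix.of F)

/-- The syzygy module `Syz_N(F) = {p ∈ R^r : pF ∈ N}`. -/
noncomputable def Syz {K : Type} [Field K] {n r s : ℕ}
    (N : Submodule (MvPolynomial (Fin n) K) (Fin s → MvPolynomial (Fin n) K))
    (F : Fin r → Fin s → MvPolynomial (Fin n) K) :
    Submodule (MvPolynomial (Fin n) K) (Fin r → MvPolynomial (Fin n) K) :=
  Submodule.comap (vecMulLin F) N

/-- `keepIdx K μ π j` holds iff `Xⱼ·μ_π` does not belong to the submodule of `R^r`
generated by the monomials `μ i`, `i ≠ π`. -/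
def keepIdx (K : Type) [Field K] {n r k : ℕ} (μ : Fin k → ModMon n r) (π : Fin k)
    (j : Fin n) : Prop :=
  monElem K (smulMon (Finsupp.single j 1) (μ π)) ∉
    Submodule.span (MvPolynomial (Fin n) K)
      {v | ∃ i : Fin k, i ≠ π ∧ v = monElem K (μ i)}

/-- The rows of the submatrix of the elementary matrix with pivot `π` keeping,
among the rows `(Xⱼ - αⱼ) ε_π`, only those with `P j`. -/
noncomputable def prunedRow {K : Type} [Field K] {n k : ℕ} (π : Fin k)
    (lam : Fin k → K) (α : Fin n → K) (P : Fin n → Prop) :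
    ({i : Fin k // i ≠ π} ⊕ {j : Fin n // P j}) → Fin k → MvPolynomial (Fin n) K :=
  Sum.elim
    (fun i => Pi.single i.1 (1 : MvPolynomial (Fin n) K)
      + lam i.1 • (Pi.single π 1 : Fin k → MvPolynomial (Fin n) K))
    (fun j => (X j.1 - C (α j.1)) • (Pi.single π 1 : Fin k → MvPolynomial (Fin n) K))

theorem ModMonomialOrder.smulMon_le_smulMon_left {n r : ℕ} (ord : ModMonomialOrder n r)
    (ν : Fin n →₀ ℕ) {μ₁ μ₂ : ModMon n r} (h : ord.le μ₁ μ₂) :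
    ord.le (smulMon ν μ₁) (smulMon ν μ₂) :=
  (ord.compat ν μ₁ μ₂ h).2

theorem ModMonomialOrder.smulMon_le_smulMon_right {n r : ℕ} (ord : ModMonomialOrder n r)
    {ν₁ ν₂ : Fin n →₀ ℕ} (μ : ModMon n r) (h : ord.le (ν₁, μ.2) (ν₂, μ.2)) :
    ord.le (smulMon ν₁ μ) (smulMon ν₂ μ) := by
  simpa [smulMon, add_comm] using ord.smulMon_le_smulMon_left μ.1 h

/-- If `ī` is the support of `lm(p)`, then
`lm(q·p) = lm_{≤_ī}(q) · lm(p)`, where `≤_ī` is the order induced on `R` by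
comparing on the `ī`-th coordinate. -/
theorem statement0 {K : Type} [Field K] {n r : ℕ} (ord : ModMonomialOrder n r)
    (q : MvPolynomial (Fin n) K) (p : Fin r → MvPolynomial (Fin n) K)
    (hq : q ≠ 0) (hp : p ≠ 0)
    (μ : ModMon n r) (hμ : IsLM ord p μ)
    (ν : Fin n →₀ ℕ) (hν : coeff ν q ≠ 0)
    (hνmax : ∀ m : Fin n →₀ ℕ, coeff m q ≠ 0 → ord.le (m, μ.2) (ν, μ.2)) :
    IsLM ord (q • p) (smulMon ν μ) := by
  constructor
  · suffices coeff (ν + μ.1) (q * p μ.2) = coeff ν q * coeff μ.1 (p μ.2) by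
      simpa only [smulMon, Pi.smul_apply, smul_eq_mul, this] using mul_ne_zero hν hμ.1
    rw [coeff_mul]
    refine Finset.sum_eq_single (ν, μ.1) ?_ (by simp)
    rintro ⟨a, b⟩ hab hne
    rw [Finset.HasAntidiagonal.mem_antidiagonal] at hab
    dsimp only at hab ⊢
    by_contra hab0
    have ha := left_ne_zero_of_mul hab0
    have hb := right_ne_zero_of_mul hab0
    have h₁ : ord.le (smulMon a (b, μ.2)) (smulMon a μ) :=
      ord.smulMon_le_smulMon_left a (hμ.2 b μ.2 hb)
    have h₂ : ord.le (smulMon a μ) (smulMon ν μ) :=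
      ord.smulMon_le_smulMon_right μ (hνmax a ha)
    have h₃ : smulMon a (b, μ.2) = smulMon ν μ := by simp only [smulMon, hab]
    have h₄ : smulMon a μ = smulMon ν μ := ord.le_antisymm _ _ h₂ (h₃ ▸ h₁)
    obtain rfl : a = ν := by simpa [smulMon] using h₄
    exact hne (by simpa using hab)
  · intro m i hm
    rw [Pi.smul_apply, smul_eq_mul, coeff_mul] at hm
    obtain ⟨⟨a, b⟩, hab, hab0⟩ := Finset.exists_ne_zero_of_sum_ne_zero hm
    obtain rfl : a + b = m := Finset.HasAntidiagonal.mem_antidiagonal.mp hab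
    exact ord.le_trans _ _ _
      (ord.smulMon_le_smulMon_left a (hμ.2 b i (right_ne_zero_of_mul hab0)))
      (ord.smulMon_le_smulMon_right μ (hνmax a (left_ne_zero_of_mul hab0)))
end

section
/- Let M be an R-submodule of R^r such that R^r/M has dimension 1 as a K-vector space, and let ≤ be a monomial order on R^r. Then the reduced ≤-Gröbner basis of M consists of the r+n−1 elements e_i + λ_i e_π for i ∈ {1,…,r}\{π} and (X_j − α_j)e_π for j = 1,…,n, for some pivot index π ∈ {1,…,r} and scalars λ_i, α_j ∈ K, where moreover λ_i = 0 whenever e_i < e_π. -/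
open MvPolynomial

namespace ModMonomialOrder

variable {n r : ℕ} (ord : ModMonomialOrder n r)

lemma unit_le (m : Fin n →₀ ℕ) (i : Fin r) : ord.le (0, i) (m, i) := by
  simpa [smulMon] using (ord.compat m (0, i) (0, i) (ord.le_refl _)).1

/-- Among the coordinate vectors whose index satisfies `P`, there is a smallest one. -/
lemma exists_min_unit {P : Fin r → Prop} (hP : ∃ i, P i) :
    ∃ i, P i ∧ ∀ j, P j → ord.le (0, i) (0, j) := by
  classical
  let le' : Fin r → Fin r → Prop := fun i j => ord.le (0, i) (0, j)
  have key : ∀ s : Finset (Fin r), s.Nonempty → ∃ i ∈ s, ∀ j ∈ s, le' i j := by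
    intro s hs
    induction hs using Finset.Nonempty.cons_induction with
    | singleton a => exact ⟨a, by simp, by simpa [le'] using ord.le_refl _⟩
    | cons a s ha hs ih =>
      obtain ⟨i, hi, hmin⟩ := ih
      rcases ord.le_total (0, a) (0, i) with h | h
      · refine ⟨a, by simp, fun j hj => ?_⟩
        rcases Finset.mem_cons.1 hj with rfl | hj
        · exact ord.le_refl _
        · exact ord.le_trans _ _ _ h (hmin j hj)
      · refine ⟨i, by simp [hi], fun j hj => ?_⟩
        rcases Finset.mem_cons.1 hj with rfl | hj
        · exact h
        · exact hmin j hj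
  obtain ⟨i, hi, hmin⟩ := key (Finset.univ.filter P) (by
    obtain ⟨i, hi⟩ := hP
    exact ⟨i, by simpa using hi⟩)
  exact ⟨i, by simpa using hi, fun j hj => hmin j (by simpa using hj)⟩

end ModMonomialOrder

lemma IsLM.unique {K : Type} [Field K] {n r : ℕ} {ord : ModMonomialOrder n r}
    {p : Fin r → MvPolynomial (Fin n) K} {μ μ' : ModMon n r}
    (h : IsLM ord p μ) (h' : IsLM ord p μ') : μ = μ' :=
  ord.le_antisymm _ _ (h'.2 _ _ h.1) (h.2 _ _ h'.1)

lemma smul_monElem {K : Type} [Field K] {n r : ℕ} (ν : Fin n →₀ ℕ) (μ : ModMon n r) :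
    monomial ν (1 : K) • monElem K μ = monElem K (smulMon ν μ) := by
  simp only [monElem, smulMon]
  rw [← Pi.single_smul, smul_eq_mul, monomial_mul, one_mul]

/-- A submodule of `R^r` of codimension one is the kernel of a nonzero functional
`p ↦ ∑ i, p i (α) * c i`. -/
lemma exists_eval_functional {K : Type} [Field K] {n r : ℕ}
    (M : Submodule (MvPolynomial (Fin n) K) (Fin r → MvPolynomial (Fin n) K))
    (hM : Module.finrank K
      ((Fin r → MvPolynomial (Fin n) K) ⧸ M.restrictScalars K) = 1) :
    ∃ (α : Fin n → K) (c : Fin r → K), (∃ i, c i ≠ 0) ∧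
      ∀ p, p ∈ M ↔ ∑ i, eval α (p i) * c i = 0 := by
  classical
  obtain ⟨e⟩ := Module.nonempty_linearEquiv_of_finrank_eq_one hM
  let φ : (Fin r → MvPolynomial (Fin n) K) →ₗ[K] K :=
    e.symm.toLinearMap ∘ₗ (M.restrictScalars K).mkQ
  have hker : ∀ p, p ∈ M ↔ φ p = 0 := fun p => by simp [φ]
  obtain ⟨v, hv⟩ : ∃ v, φ v = 1 :=
    (e.symm.surjective.comp (M.restrictScalars K).mkQ_surjective) 1
  have hmul : ∀ (q : MvPolynomial (Fin n) K) w, φ (q • w) = φ (q • v) * φ w := by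
    intro q w
    have hw : w - φ w • v ∈ M := by rw [hker]; simp [hv]
    have h := (hker _).1 (M.smul_mem q hw)
    rwa [smul_sub, smul_comm q (φ w) v, map_sub, φ.map_smul, sub_eq_zero, smul_eq_mul,
      mul_comm] at h
  have heval : ∀ (q : MvPolynomial (Fin n) K) w,
      φ (q • w) = eval (fun j => φ (X (R := K) j • v)) q * φ w := by
    intro q
    induction q using MvPolynomial.induction_on with
    | C a =>
      intro w
      rw [← MvPolynomial.algebraMap_eq, algebraMap_smul, map_smul, MvPolynomial.algebraMap_eq,
        eval_C, smul_eq_mul]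
    | add p q hp hq => intro w; rw [add_smul, map_add, hp, hq, map_add, add_mul]
    | mul_X p j hp => intro w; rw [mul_smul, hp, hmul, map_mul, eval_X, mul_assoc]
  have hsum : ∀ p, φ p = ∑ i, eval (fun j => φ (X (R := K) j • v)) (p i) *
      φ (Pi.single i 1) := by
    intro p
    conv_lhs => rw [← Finset.univ_sum_single p, map_sum]
    refine Finset.sum_congr rfl fun i _ => ?_
    rw [← heval, ← Pi.single_smul, smul_eq_mul, mul_one]
  refine ⟨fun j => φ (X (R := K) j • v), fun i => φ (Pi.single i 1), ?_, fun p => ?_⟩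
  · by_contra! h
    rw [hsum] at hv
    simp [h] at hv
  · rw [hker, hsum]

/-- The leading monomials of the rows of an elementary matrix. -/
noncomputable def elemLM {n k : ℕ} (π : Fin k) :
    ({i : Fin k // i ≠ π} ⊕ Fin n) → ModMon n k :=
  Sum.elim (fun i => (0, i.1)) (fun j => (Finsupp.single j 1, π))

section ElementaryRows

variable {K : Type} [Field K] {n k : ℕ} {π : Fin k} {lam : Fin k → K} {α : Fin n → K}

lemma coeff_elemLM (a : {i : Fin k // i ≠ π} ⊕ Fin n) :
    coeff (elemLM π a).1 (elemRow π lam α a (elemLM π a).2) = 1 := by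
  classical
  rcases a with ⟨i, hi⟩ | j
  · simp [elemLM, elemRow, hi]
  · have h : (0 : Fin n →₀ ℕ) ≠ Finsupp.single j 1 := by simp [eq_comm]
    simp [elemLM, elemRow, coeff_C, coeff_X, h]

lemma mem_support_elemRow {a : {i : Fin k // i ≠ π} ⊕ Fin n} {m : Fin n →₀ ℕ} {l : Fin k}
    (h : coeff m (elemRow π lam α a l) ≠ 0) :
    (m, l) = elemLM π a ∨ ((m, l) = (0, π) ∧ ∀ i, a = Sum.inl i → lam i ≠ 0) := by
  classical
  rcases a with ⟨i, hi⟩ | j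
  · by_cases hl : l = i
    · subst hl
      left
      by_contra hm
      apply h
      have : (0 : Fin n →₀ ℕ) ≠ m := by rintro rfl; exact hm rfl
      simp [elemRow, hi, coeff_one, this]
    · right
      by_cases hl' : l = π
      · subst hl'
        simp only [elemRow, Sum.elim_inl, Pi.add_apply, Pi.smul_apply, Pi.single_eq_same,
          Pi.single_eq_of_ne hl, zero_add, coeff_smul, smul_eq_mul, coeff_one] at h
        refine ⟨?_, fun i' hi' => ?_⟩
        · by_cases hm : 0 = m
          · rw [hm]
          · simp [hm] at h
        · cases hi'
          exact left_ne_zero_of_mul h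
      · simp [elemRow, hl, hl'] at h
  · by_cases hl : l = π
    · subst hl
      by_cases hm : 0 = m
      · right; exact ⟨by rw [hm], by simp⟩
      · left
        by_contra hm'
        have : Finsupp.single j 1 ≠ m := by rintro rfl; exact hm' rfl
        simp [elemRow, coeff_C, coeff_X, hm, this] at h
    · simp [elemRow, hl] at h

lemma isLM_elemRow {ord : ModMonomialOrder n k}
    (hlam : ∀ i, lam i ≠ 0 → ord.le (0, π) (0, i))
    (a : {i : Fin k // i ≠ π} ⊕ Fin n) : IsLM ord (elemRow π lam α a) (elemLM π a) := by
  refine ⟨by rw [coeff_elemLM]; exact one_ne_zero, fun m l h => ?_⟩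
  rcases mem_support_elemRow h with h | ⟨h, hne⟩
  · rw [h]; exact ord.le_refl _
  · rw [h]
    rcases a with i | j
    · exact hlam _ (hne i rfl)
    · exact ord.unit_le _ _

lemma not_monDvd_elemLM_unit (a : {i : Fin k // i ≠ π} ⊕ Fin n) :
    ¬ monDvd (elemLM π a) (0, π) := by
  rintro ⟨ν, hν⟩
  rcases a with ⟨i, hi⟩ | j
  · exact hi (congrArg Prod.snd hν)
  · have := DFunLike.congr_fun (congrArg Prod.fst hν) j
    simp [smulMon, elemLM] at this

lemma not_monDvd_elemLM {a b : {i : Fin k // i ≠ π} ⊕ Fin n} (hab : a ≠ b) :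
    ¬ monDvd (elemLM π a) (elemLM π b) := by
  rintro ⟨ν, hν⟩
  have h1 := congrArg Prod.fst hν
  have h2 := congrArg Prod.snd hν
  rcases a with ⟨i, hi⟩ | j <;> rcases b with ⟨i', hi'⟩ | j' <;>
    simp only [smulMon, elemLM, Sum.elim_inl, Sum.elim_inr] at h1 h2
  · subst h2; exact hab rfl
  · exact hi h2
  · exact hi' h2.symm
  · have h := DFunLike.congr_fun h1 j
    have hj : j' ≠ j := by rintro rfl; exact hab rfl
    simp [Finsupp.single_eq_of_ne' hj] at h

lemma exists_elemLM_monDvd {μ : ModMon n k} (hμ : μ ≠ (0, π)) :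
    ∃ a, monDvd (elemLM π a) μ := by
  obtain ⟨m, i⟩ := μ
  by_cases hi : i = π
  · subst hi
    have hm : m ≠ 0 := by rintro rfl; exact hμ rfl
    obtain ⟨j, hj⟩ := Finsupp.ne_iff.1 hm
    refine ⟨Sum.inr j, m - Finsupp.single j 1, ?_⟩
    have hle : Finsupp.single j 1 ≤ m := by
      rw [Finsupp.single_le_iff]
      exact Nat.one_le_iff_ne_zero.2 hj
    simp [smulMon, elemLM, tsub_add_cancel_of_le hle]
  · exact ⟨Sum.inl ⟨i, hi⟩, m, by simp [smulMon, elemLM]⟩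

end ElementaryRows

/-- If `R^r/M` has `K`-dimension `1`, then for any monomial
order `≤` the reduced `≤`-Gröbner basis of `M` consists of the `r+n-1` elements
`eᵢ + λᵢ e_π` (`i ≠ π`) and `(Xⱼ - αⱼ) e_π` (`1 ≤ j ≤ n`), with `λᵢ = 0`
whenever `eᵢ < e_π`. -/
theorem statement1 {K : Type} [Field K] {n r : ℕ}
    (M : Submodule (MvPolynomial (Fin n) K) (Fin r → MvPolynomial (Fin n) K))
    (hM : Module.finrank K
      ((Fin r → MvPolynomial (Fin n) K) ⧸ M.restrictScalars K) = 1)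
    (ord : ModMonomialOrder n r) :
    ∃ (π : Fin r) (lam : Fin r → K) (α : Fin n → K),
      IsReducedGB ord M (elemRow π lam α) ∧
      ∀ i : Fin r, i ≠ π →
        ord.lt ((0 : Fin n →₀ ℕ), i) ((0 : Fin n →₀ ℕ), π) → lam i = 0 := by
  classical
  obtain ⟨α, c, hc, hmem⟩ := exists_eval_functional M hM
  obtain ⟨π, hπ, hmin⟩ := ord.exists_min_unit hc
  let lam : Fin r → K := fun i => -(c i / c π)
  have hlam : ∀ i, lam i ≠ 0 → ord.le (0, π) (0, i) := fun i hi =>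
    hmin i (by rintro h; simp [lam, h] at hi)
  have hLM := isLM_elemRow (π := π) (α := α) hlam
  have hG : ∀ a, elemRow π lam α a ∈ M := by
    intro a
    rw [hmem]
    rcases a with ⟨i, hi⟩ | j
    · have : ∀ x, eval α (elemRow π lam α (Sum.inl ⟨i, hi⟩) x) * c x =
          (if x = i then c x else 0) + (if x = π then lam i * c x else 0) := by
        intro x
        simp only [elemRow, Sum.elim_inl, Pi.add_apply, Pi.smul_apply, Pi.single_apply,
          map_add, smul_eval]
        split_ifs <;> simp
        ring
      simp only [this, Finset.sum_add_distrib, Finset.sum_ite_eq', Finset.mem_univ, if_true, lam]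
      field_simp
      ring
    · refine Finset.sum_eq_zero fun x _ => ?_
      simp [elemRow]
  have hnot : ∀ p ∈ M, ¬ IsLM ord p (0, π) := by
    rintro p hp ⟨hne, hle⟩
    have hconst : p π = C (coeff 0 (p π)) := by
      ext m
      rw [coeff_C]
      split_ifs with h
      · rw [h]
      · by_contra hm
        exact h (congrArg Prod.fst (ord.le_antisymm _ _ (ord.unit_le m π) (hle m π hm)))
    have hzero : ∀ i, i ≠ π → eval α (p i) * c i = 0 := by
      intro i hi
      by_contra h
      obtain ⟨m, hm⟩ := ne_zero_iff.1
        (fun h0 : p i = 0 => left_ne_zero_of_mul h (by rw [h0, map_zero]))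
      have h1 := ord.le_trans _ _ _ (ord.unit_le m i) (hle m i hm)
      exact hi (congrArg Prod.snd
        (ord.le_antisymm _ _ h1 (hmin i (right_ne_zero_of_mul h))))
    have h := (hmem p).1 hp
    rw [Finset.sum_eq_single π (fun i _ => hzero i) (by simp), hconst, eval_C] at h
    exact mul_ne_zero hne hπ h
  refine ⟨π, lam, α, ⟨⟨⟨hG, ?_⟩, ?_⟩, ?_, ?_⟩, ?_⟩
  · apply le_antisymm
    · refine Submodule.span_le.2 ?_
      rintro _ ⟨p, hp, μ, hμ, rfl⟩
      obtain ⟨a, ν, rfl⟩ := exists_elemLM_monDvd (π := π) (μ := μ)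
        (by rintro rfl; exact hnot p hp hμ)
      rw [← smul_monElem]
      exact Submodule.smul_mem _ _ (Submodule.subset_span ⟨a, _, hLM a, rfl⟩)
    · refine Submodule.span_mono ?_
      rintro _ ⟨a, μ, hμ, rfl⟩
      exact ⟨_, hG a, μ, hμ, rfl⟩
  · intro a b hab μ μ' hμ hμ'
    rw [hμ.unique (hLM a), hμ'.unique (hLM b)]
    exact not_monDvd_elemLM hab
  · intro a μ hμ
    rw [hμ.unique (hLM a)]
    exact coeff_elemLM a
  · intro a b hab μ hμ m l h
    rw [hμ.unique (hLM b)]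
    rcases mem_support_elemRow h with h | ⟨h, -⟩
    · rw [h]; exact not_monDvd_elemLM hab.symm
    · rw [h]; exact not_monDvd_elemLM_unit b
  · intro i _ hlt
    by_contra h
    exact hlt.2 (ord.le_antisymm _ _ hlt.1 (hlam i h))
end

section
/- Let ≤ be a monomial order on R^r and LM = (μ₁,…,μ_k) a list of monomials of R^r. Define a relation ≺ on the monomials of R^k by: ν₁ε_i ≺ ν₂ε_j if and only if ν₁μ_i < ν₂μ_j, or (ν₁μ_i = ν₂μ_j and i < j). Then ≺ (together with equality) is a monomial order on R^k and a Schreyer order for ≤ and LM. In particular, for every monomial order ≤ on R^r and every list LM of monomials of R^r, a Schreyer order for ≤ and LM exists. -/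
open MvPolynomial

/-- The explicit Schreyer relation: `ν₁ εᵢ ⪯ ν₂ εⱼ` iff they are equal, or
`ν₁ μᵢ < ν₂ μⱼ`, or (`ν₁ μᵢ = ν₂ μⱼ` and `i < j`). -/
noncomputable def schreyerRel {n r k : ℕ} (ord : ModMonomialOrder n r)
    (LM : Fin k → ModMon n r) : ModMon n k → ModMon n k → Prop :=
  fun a b => a = b ∨
    ord.lt (smulMon a.1 (LM a.2)) (smulMon b.1 (LM b.2)) ∨
    (smulMon a.1 (LM a.2) = smulMon b.1 (LM b.2) ∧ a.2 < b.2)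

theorem smulMon_injective {n r : ℕ} (ν : Fin n →₀ ℕ) :
    Function.Injective (smulMon ν : ModMon n r → ModMon n r) := by
  rintro ⟨a, i⟩ ⟨b, j⟩ h
  simpa [smulMon] using h

theorem smulMon_left_injective {n r : ℕ} (μ : ModMon n r) :
    Function.Injective fun ν : Fin n →₀ ℕ => smulMon ν μ := by
  intro a b h
  simpa [smulMon] using h

theorem smulMon_add {n r : ℕ} (ν ν' : Fin n →₀ ℕ) (μ : ModMon n r) :
    smulMon (ν + ν') μ = smulMon ν (smulMon ν' μ) := by
  simp [smulMon, add_assoc]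

namespace ModMonomialOrder

variable {n r : ℕ} (ord : ModMonomialOrder n r)

theorem lt_trans {a b c : ModMon n r} (hab : ord.lt a b) (hbc : ord.lt b c) : ord.lt a c := by
  refine ⟨ord.le_trans _ _ _ hab.1 hbc.1, ?_⟩
  rintro rfl
  exact hab.2 (ord.le_antisymm _ _ hab.1 hbc.1)

theorem lt_asymm {a b : ModMon n r} (hab : ord.lt a b) : ¬ ord.lt b a :=
  fun hba => hab.2 (ord.le_antisymm _ _ hab.1 hba.1)

theorem lt_trichotomy (a b : ModMon n r) : ord.lt a b ∨ a = b ∨ ord.lt b a := by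
  by_cases h : a = b
  · exact .inr (.inl h)
  · rcases ord.le_total a b with hab | hba
    · exact .inl ⟨hab, h⟩
    · exact .inr (.inr ⟨hba, Ne.symm h⟩)

theorem smulMon_lt_smulMon (ν : Fin n →₀ ℕ) {a b : ModMon n r} (h : ord.lt a b) :
    ord.lt (smulMon ν a) (smulMon ν b) :=
  ⟨(ord.compat ν a b h.1).2, (smulMon_injective ν).ne h.2⟩

theorem le_smulMon (ν : Fin n →₀ ℕ) (a : ModMon n r) : ord.le a (smulMon ν a) :=
  (ord.compat ν a a (ord.le_refl a)).1

end ModMonomialOrder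

section SchreyerRel

variable {n r k : ℕ} (ord : ModMonomialOrder n r) (LM : Fin k → ModMon n r)

theorem schreyerRel_trans {a b c : ModMon n k} (hab : schreyerRel ord LM a b)
    (hbc : schreyerRel ord LM b c) : schreyerRel ord LM a c := by
  rcases hab with rfl | hab | ⟨hab, hab'⟩
  · exact hbc
  · rcases hbc with rfl | hbc | ⟨hbc, -⟩
    · exact .inr (.inl hab)
    · exact .inr (.inl (ord.lt_trans hab hbc))
    · exact .inr (.inl (hbc ▸ hab))
  · rcases hbc with rfl | hbc | ⟨hbc, hbc'⟩
    · exact .inr (.inr ⟨hab, hab'⟩)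
    · exact .inr (.inl (hab ▸ hbc))
    · exact .inr (.inr ⟨hab.trans hbc, hab'.trans hbc'⟩)

theorem schreyerRel_antisymm {a b : ModMon n k} (hab : schreyerRel ord LM a b)
    (hba : schreyerRel ord LM b a) : a = b := by
  rcases hab with rfl | hab | ⟨hab, hab'⟩
  · rfl
  · rcases hba with rfl | hba | ⟨hba, -⟩
    · rfl
    · exact (ord.lt_asymm hab hba).elim
    · exact (hab.2 hba.symm).elim
  · rcases hba with rfl | hba | ⟨-, hba'⟩
    · rfl
    · exact (hba.2 hab.symm).elim
    · exact (lt_asymm hab' hba').elim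

theorem schreyerRel_total (a b : ModMon n k) :
    schreyerRel ord LM a b ∨ schreyerRel ord LM b a := by
  rcases ord.lt_trichotomy (smulMon a.1 (LM a.2)) (smulMon b.1 (LM b.2)) with h | h | h
  · exact .inl (.inr (.inl h))
  · rcases _root_.lt_trichotomy a.2 b.2 with hi | hi | hi
    · exact .inl (.inr (.inr ⟨h, hi⟩))
    · refine .inl (.inl (Prod.ext (smulMon_left_injective (LM b.2) ?_) hi))
      simpa only [hi] using h
    · exact .inr (.inr (.inr ⟨h.symm, hi⟩))
  · exact .inr (.inr (.inl h))

theorem smulMon_smulMon_index (ν : Fin n →₀ ℕ) (a : ModMon n k) :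
    smulMon (smulMon ν a).1 (LM (smulMon ν a).2) = smulMon ν (smulMon a.1 (LM a.2)) :=
  smulMon_add ν a.1 (LM a.2)

theorem schreyerRel_self_smulMon (ν : Fin n →₀ ℕ) (a : ModMon n k) :
    schreyerRel ord LM a (smulMon ν a) := by
  by_cases h : a = smulMon ν a
  · exact .inl h
  · refine .inr (.inl ⟨?_, fun e => h (Prod.ext (smulMon_left_injective _ e) rfl)⟩)
    rw [smulMon_smulMon_index]
    exact ord.le_smulMon ν _

theorem schreyerRel_smulMon_smulMon (ν : Fin n →₀ ℕ) {a b : ModMon n k}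
    (h : schreyerRel ord LM a b) : schreyerRel ord LM (smulMon ν a) (smulMon ν b) := by
  rcases h with rfl | h | ⟨h, hi⟩
  · exact .inl rfl
  · refine .inr (.inl ?_)
    simpa only [smulMon_smulMon_index] using ord.smulMon_lt_smulMon ν h
  · refine .inr (.inr ⟨?_, hi⟩)
    rw [smulMon_smulMon_index, smulMon_smulMon_index, h]

/-- The monomial order on `R^k` whose relation is `schreyerRel`. -/
noncomputable def schreyerOrder : ModMonomialOrder n k where
  le := schreyerRel ord LM
  le_refl _ := .inl rfl
  le_trans _ _ _ := schreyerRel_trans ord LM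
  le_antisymm _ _ := schreyerRel_antisymm ord LM
  le_total := schreyerRel_total ord LM
  compat ν a _ h := ⟨schreyerRel_self_smulMon ord LM ν a, schreyerRel_smulMon_smulMon ord LM ν h⟩

end SchreyerRel

/-- The explicit relation `schreyerRel` is a monomial order on
`R^k` and a Schreyer order for `≤` and `LM`; in particular Schreyer orders
always exist. -/
theorem statement3 {n r k : ℕ} (ord : ModMonomialOrder n r)
    (LM : Fin k → ModMon n r) :
    ∃ sord : ModMonomialOrder n k,
      sord.le = schreyerRel ord LM ∧ IsSchreyerOrder ord LM sord := by
  exact ⟨schreyerOrder ord LM, rfl, fun _ _ _ _ h => .inr (.inl h)⟩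
end

section
/- Let ≤ be a monomial order on R^r, let G = (p₁,…,p_k) ∈ R^{k×r} be a ≤-Gröbner basis with μ_i = lm_≤(p_i), let ≺ be a Schreyer order for ≤ and LM = (μ₁,…,μ_k), and let E ∈ R^{(k+n−1)×k} be elementary with pivot π, constants λ_i and α_j, such that λ_i = 0 whenever ε_i ≺ ε_π strictly. If μ_i ≠ μ_π for all i ≠ π, then the list of ≤-leading monomials of the rows of the product EG equals (μ₁,…,μ_{π−1}, X₁μ_π,…,Xₙμ_π, μ_{π+1},…,μ_k); equivalently lm_≤(EG) = lm_≺(E)·LM. -/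
open MvPolynomial

theorem rowMul_elemRow_inl {K : Type} [Field K] {n r k : ℕ}
    (G : Fin k → Fin r → MvPolynomial (Fin n) K) (π : Fin k) (lam : Fin k → K)
    (α : Fin n → K) (i : {i : Fin k // i ≠ π}) :
    rowMul (elemRow π lam α) G (Sum.inl i) = G i.1 + lam i.1 • G π := by
  funext c
  simp [rowMul, elemRow, add_mul, Finset.sum_add_distrib, Pi.single_apply]

theorem rowMul_elemRow_inr {K : Type} [Field K] {n r k : ℕ}
    (G : Fin k → Fin r → MvPolynomial (Fin n) K) (π : Fin k) (lam : Fin k → K)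
    (α : Fin n → K) (j : Fin n) :
    rowMul (elemRow π lam α) G (Sum.inr j) = (X j - C (α j)) • G π := by
  funext c
  simp [rowMul, elemRow, Pi.single_apply]

/-- Adding a multiple of an element with strictly smaller leading monomial does not
change the leading monomial. -/
theorem IsLM.add_smul_of_lt {K : Type} [Field K] {n r : ℕ} {ord : ModMonomialOrder n r}
    {p q : Fin r → MvPolynomial (Fin n) K} {μ ν : ModMon n r}
    (hp : IsLM ord p μ) (hq : IsLM ord q ν) (hlt : ord.lt ν μ) (a : K) :
    IsLM ord (p + a • q) μ := by
  have hq0 : coeff μ.1 (q μ.2) = 0 := by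
    by_contra h
    exact hlt.2 (ord.le_antisymm _ _ hlt.1 (hq.2 _ _ h))
  refine ⟨by simpa [hq0] using hp.1, fun m i hm => ?_⟩
  by_cases hpm : coeff m (p i) = 0
  · have hqm : coeff m (q i) ≠ 0 := by
      intro h
      simp [hpm, h] at hm
    exact ord.le_trans _ _ _ (hq.2 m i hqm) hlt.1
  · exact hp.2 m i hpm

/-- Multiplication by `Xⱼ - a` multiplies the leading monomial by `Xⱼ`. -/
theorem IsLM.X_sub_C_smul {K : Type} [Field K] {n r : ℕ} {ord : ModMonomialOrder n r}
    {p : Fin r → MvPolynomial (Fin n) K} {μ : ModMon n r}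
    (hp : IsLM ord p μ) (j : Fin n) (a : K) :
    IsLM ord ((X j - C a) • p) (smulMon (Finsupp.single j 1) μ) := by
  have hle : ord.le μ (smulMon (Finsupp.single j 1) μ) :=
    (ord.compat _ μ μ (ord.le_refl μ)).1
  have hp0 : coeff (Finsupp.single j 1 + μ.1) (p μ.2) = 0 := by
    by_contra h
    have heq := congrArg Prod.fst (ord.le_antisymm _ _ hle (hp.2 _ _ h))
    simp [smulMon] at heq
  refine ⟨?_, fun m i hm => ?_⟩
  · simpa [smulMon, sub_mul, coeff_X_mul, coeff_C_mul, hp0] using hp.1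
  · by_cases hpm : coeff m (p i) = 0
    · have hX : coeff m (X j * p i) ≠ 0 := by
        simpa [sub_mul, coeff_C_mul, hpm] using hm
      rw [coeff_X_mul'] at hX
      obtain ⟨hj, hX⟩ := ite_ne_right_iff.mp hX
      have hm' : Finsupp.single j 1 + (m - Finsupp.single j 1) = m :=
        add_tsub_cancel_of_le
          (Finsupp.single_le_iff.mpr (Nat.one_le_iff_ne_zero.mpr (Finsupp.mem_support_iff.mp hj)))
      have h := (ord.compat (Finsupp.single j 1) _ _ (hp.2 _ i hX)).2
      simpa only [smulMon, hm'] using h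
    · exact ord.le_trans _ _ _ (hp.2 m i hpm) hle

/-- If `μᵢ ≠ μ_π` for all `i ≠ π`, the leading monomials of the
rows of `E·G` are `μᵢ` (for the rows indexed by `i ≠ π`) and `Xⱼ μ_π` (for the
rows indexed by `1 ≤ j ≤ n`). -/
theorem statement5 {K : Type} [Field K] {n r k : ℕ}
    (ord : ModMonomialOrder n r)
    (G : Fin k → Fin r → MvPolynomial (Fin n) K)
    (hGB : IsGB ord
      (Submodule.span (MvPolynomial (Fin n) K) (Set.range G)) G)
    (μ : Fin k → ModMon n r) (hμ : ∀ i, IsLM ord (G i) (μ i))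
    (sord : ModMonomialOrder n k) (hs : IsSchreyerOrder ord μ sord)
    (π : Fin k) (lam : Fin k → K) (α : Fin n → K)
    (hlam : ∀ i : Fin k, i ≠ π →
      sord.lt ((0 : Fin n →₀ ℕ), i) ((0 : Fin n →₀ ℕ), π) → lam i = 0)
    (hdist : ∀ i : Fin k, i ≠ π → μ i ≠ μ π) :
    (∀ (i : Fin k) (h : i ≠ π),
      IsLM ord (rowMul (elemRow π lam α) G (Sum.inl ⟨i, h⟩)) (μ i)) ∧
    (∀ j : Fin n,
      IsLM ord (rowMul (elemRow π lam α) G (Sum.inr j))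
        (smulMon (Finsupp.single j 1) (μ π))) := by
  refine ⟨fun i h => ?_, fun j => ?_⟩
  · rw [rowMul_elemRow_inl]
    by_cases hl : lam i = 0
    · simpa [hl] using hμ i
    · have hlt : ord.lt (μ π) (μ i) := by
        refine ⟨(ord.le_total (μ π) (μ i)).resolve_right fun hle => hl ?_, (hdist i h).symm⟩
        refine hlam i h ⟨hs 0 0 i π ?_, by simpa using h⟩
        simpa [smulMon, ModMonomialOrder.lt] using And.intro hle (hdist i h)
      exact (hμ i).add_smul_of_lt (hμ π) hlt (lam i)
  · rw [rowMul_elemRow_inr]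
    exact (hμ π).X_sub_C_smul j (α j)
end
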